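/- The limiting probability that k independent uniformly random integers in [n] are pairwise coprime, as n → ∞, equals ∏_{p prime} (1 − 1/p)^{k−1}·(1 + (k−1)/p). -/

import Mathlib

open Filter

open Finset Topology

/-- The residue class `r` modulo `M` has natural density `1 / M`. -/
lemma tendsto_card_filter_natCast_eq_div {M : ℕ} [NeZero M] (r : ZMod M) :
    Tendsto (fun n : ℕ => (#{x ∈ Icc 1 n | ((x : ℕ) : ZMod M) = r} : ℝ) / n) atTop
      (𝓝 (M : ℝ)⁻¹) := by
  have hM : (0 : ℚ) < M := by exact_mod_cast NeZero.pos M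
  have key : ∀ n : ℕ, |(#{x ∈ Icc 1 n | ((x : ℕ) : ZMod M) = r} : ℝ) - n * (M : ℝ)⁻¹| ≤ 1 := by
    intro n
    have hcard : ((#{x ∈ Icc 1 n | ((x : ℕ) : ZMod M) = r} : ℕ) : ℤ)
        = max (⌊((n : ℕ) - (r.val : ℕ)) / (M : ℚ)⌋ - ⌊((0 : ℕ) - (r.val : ℕ)) / (M : ℚ)⌋) 0 := by
      rw [← Nat.Ioc_filter_modEq_card 0 n (NeZero.pos M) r.val]
      congr 2
      ext x
      simp only [mem_filter, mem_Icc, mem_Ioc, ← ZMod.natCast_eq_natCast_iff,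
        ZMod.natCast_zmod_val, Nat.succ_le_iff]
    have hq : |(#{x ∈ Icc 1 n | ((x : ℕ) : ZMod M) = r} : ℚ) - n * (M : ℚ)⁻¹| ≤ 1 := by
      have h0 : (0 : ℚ) ≤ n * (M : ℚ)⁻¹ := by positivity
      have hcast := congrArg (Int.cast : ℤ → ℚ) hcard
      push_cast at hcast
      rw [hcast]
      have h1 := Int.floor_le (((n : ℚ) - (r.val : ℚ)) / (M : ℚ))
      have h2 := Int.lt_floor_add_one (((n : ℚ) - (r.val : ℚ)) / (M : ℚ))
      have h3 := Int.floor_le (((0 : ℚ) - (r.val : ℚ)) / (M : ℚ))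
      have h4 := Int.lt_floor_add_one (((0 : ℚ) - (r.val : ℚ)) / (M : ℚ))
      have h5 : ((n : ℚ) - (r.val : ℚ)) / M - ((0 : ℚ) - (r.val : ℚ)) / M = n * (M : ℚ)⁻¹ := by
        ring
      rw [abs_le]
      rcases max_cases
        ((⌊((n : ℚ) - (r.val : ℚ)) / (M : ℚ)⌋ : ℚ) - ⌊((0 : ℚ) - (r.val : ℚ)) / (M : ℚ)⌋) 0
        with ⟨h, _⟩ | ⟨h, _⟩ <;> rw [h] <;> constructor <;> linarith
    have hreal := (Rat.cast_le (K := ℝ)).2 hq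
    push_cast at hreal
    exact hreal
  rw [tendsto_iff_dist_tendsto_zero]
  refine squeeze_zero' (Eventually.of_forall fun _ => dist_nonneg) ?_
    (tendsto_inv_atTop_nhds_zero_nat (𝕜 := ℝ))
  filter_upwards [eventually_gt_atTop 0] with n hn
  have hn' : (0 : ℝ) < n := by exact_mod_cast hn
  rw [Real.dist_eq, show (#{x ∈ Icc 1 n | ((x : ℕ) : ZMod M) = r} : ℝ) / n - (M : ℝ)⁻¹
    = (#{x ∈ Icc 1 n | ((x : ℕ) : ZMod M) = r} - n * (M : ℝ)⁻¹) * (n : ℝ)⁻¹ by field_simp,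
    abs_mul, abs_of_pos (inv_pos.2 hn')]
  exact mul_le_of_le_one_left (by positivity) (key n)

/-- If every fibre of `π` has density `c`, then a set of `k`-tuples determined by the values of `π`
on the coordinates has density `c ^ k` times its number of admissible value patterns. -/
lemma tendsto_card_piFinset_filter_mem_div {k : ℕ} {G : Type*} [DecidableEq G] {π : ℕ → G} {c : ℝ}
    (h : ∀ g, Tendsto (fun n : ℕ => (#{x ∈ Icc 1 n | π x = g} : ℝ) / n) atTop (𝓝 c))
    (S : Finset (Fin k → G)) :
    Tendsto (fun n : ℕ => (#{x ∈ Fintype.piFinset fun _ : Fin k => Icc 1 n |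
      (fun i => π (x i)) ∈ S} : ℝ) / (n : ℝ) ^ k) atTop (𝓝 (#S * c ^ k)) := by
  have hcard : ∀ n : ℕ, (#{x ∈ Fintype.piFinset fun _ : Fin k => Icc 1 n |
      (fun i => π (x i)) ∈ S} : ℝ) / (n : ℝ) ^ k
      = ∑ s ∈ S, ∏ i, (#{x ∈ Icc 1 n | π x = s i} : ℝ) / n := by
    intro n
    have hmaps : Set.MapsTo (fun (x : Fin k → ℕ) i => π (x i))
        ({x ∈ Fintype.piFinset fun _ : Fin k => Icc 1 n | (fun i => π (x i)) ∈ S} : Finset _) S :=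
      fun x hx => (mem_filter.1 (mem_coe.1 hx)).2
    rw [card_eq_sum_card_fiberwise hmaps, Nat.cast_sum, sum_div]
    refine sum_congr rfl fun s hs => ?_
    rw [prod_div_distrib, prod_const, card_univ, Fintype.card_fin, ← Nat.cast_prod,
      ← Fintype.card_piFinset]
    congr 3
    ext x
    simp only [mem_filter, Fintype.mem_piFinset, funext_iff]
    constructor
    · rintro ⟨⟨h1, -⟩, h2⟩ i
      exact ⟨h1 i, h2 i⟩
    · intro hx
      have : (fun i => π (x i)) = s := funext fun i => (hx i).2
      exact ⟨⟨fun i => (hx i).1, this ▸ hs⟩, fun i => (hx i).2⟩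
  simp_rw [hcard]
  have : (#S * c ^ k : ℝ) = ∑ s ∈ S, ∏ i : Fin k, c := by simp
  rw [this]
  exact tendsto_finsetSum _ fun s _ => tendsto_finsetProd _ fun i _ => h (s i)

/-- Count of the vectors over `ZMod p` with at most one zero coordinate. -/
lemma card_filter_at_most_one_zero (k p : ℕ) [NeZero p] :
    #{v : Fin k → ZMod p | ∀ i j, i ≠ j → ¬(v i = 0 ∧ v j = 0)}
      = (p - 1) ^ k + k * (p - 1) ^ (k - 1) := by
  have hdecomp : ({v | ∀ i j, i ≠ j → ¬(v i = 0 ∧ v j = 0)} : Finset (Fin k → ZMod p))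
      = (univ : Finset (Option (Fin k))).biUnion fun o =>
        Fintype.piFinset fun j => if o = some j then {(0 : ZMod p)} else {0}ᶜ := by
    ext v
    simp only [mem_filter, mem_biUnion, mem_univ, true_and, Fintype.mem_piFinset]
    constructor
    · intro h
      by_cases hv : ∃ i, v i = 0
      · obtain ⟨i, hi⟩ := hv
        refine ⟨some i, fun j => ?_⟩
        by_cases hij : i = j
        · subst hij; simp [hi]
        · simpa [hij] using fun hj => h i j hij ⟨hi, hj⟩
      · push Not at hv
        exact ⟨none, fun j => by simpa using hv j⟩
    · rintro ⟨o, ho⟩ i j hij ⟨hi, hj⟩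
      have h1 : o = some i := by
        by_contra hne; simpa [hne, hi] using ho i
      have h2 : o = some j := by
        by_contra hne; simpa [hne, hj] using ho j
      exact hij (Option.some_injective _ (h1.symm.trans h2))
  have hdisj : ((univ : Finset (Option (Fin k))) : Set (Option (Fin k))).PairwiseDisjoint fun o =>
      Fintype.piFinset fun j => if o = some j then {(0 : ZMod p)} else {0}ᶜ := by
    intro o _ o' _ hne
    rw [Function.onFun, Finset.disjoint_left]
    intro v hv hv'
    simp only [Fintype.mem_piFinset] at hv hv'
    have key : ∀ i, o = some i ↔ o' = some i := by
      intro i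
      have h1 := hv i
      have h2 := hv' i
      split_ifs at h1 h2 <;> simp_all
    exact hne (Option.ext key)
  rw [hdecomp, card_biUnion hdisj, Fintype.sum_option]
  have hcompl : #({0}ᶜ : Finset (ZMod p)) = p - 1 := by
    rw [card_compl, ZMod.card, card_singleton]
  simp only [Fintype.card_piFinset]
  congr 1
  · simp [hcompl]
  · have : ∀ i : Fin k, ∏ j, #(if some i = some j then {(0 : ZMod p)} else {0}ᶜ)
        = (p - 1) ^ (k - 1) := by
      intro i
      rw [← mul_prod_erase _ _ (mem_univ i), prod_congr rfl (g := fun _ => p - 1), prod_const,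
        card_erase_of_mem (mem_univ i)]
      · simp
      · intro j hj
        rw [if_neg (by simpa using (ne_of_mem_erase hj).symm), hcompl]
    rw [sum_congr rfl fun i _ => this i]
    simp

/-- The density of `k`-tuples such that no prime of `T` divides two of the coordinates. -/
lemma tendsto_card_no_common_prime_div {k : ℕ} (hk : 1 ≤ k) {T : Finset ℕ}
    (hT : ∀ p ∈ T, p.Prime) :
    Tendsto (fun n : ℕ => (#{x ∈ Fintype.piFinset fun _ : Fin k => Icc 1 n |
      ∀ p ∈ T, ∀ i j, i ≠ j → ¬(p ∣ x i ∧ p ∣ x j)} : ℝ) / (n : ℝ) ^ k) atTop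
      (𝓝 (∏ p ∈ T, (1 - 1 / (p : ℝ)) ^ (k - 1) * (1 + ((k : ℝ) - 1) / (p : ℝ)))) := by
  have : ∀ p : T, NeZero (p : ℕ) := fun p => ⟨(hT p p.2).ne_zero⟩
  have hcop : Pairwise (Function.onFun Nat.Coprime fun p : T => (p : ℕ)) := fun p q hpq =>
    (Nat.coprime_primes (hT p p.2) (hT q q.2)).2 fun h => hpq (Subtype.ext h)
  have : NeZero (∏ p : T, (p : ℕ)) := ⟨prod_ne_zero_iff.2 fun p _ => (hT p p.2).ne_zero⟩
  let e := ZMod.prodEquivPi (fun p : T => (p : ℕ)) hcop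
  have hfib : ∀ g : (p : T) → ZMod p,
      Tendsto (fun n : ℕ => (#{x ∈ Icc 1 n | (fun p : T => ((x : ℕ) : ZMod p)) = g} : ℝ) / n)
        atTop (𝓝 ((∏ p : T, (p : ℕ) : ℕ) : ℝ)⁻¹) := by
    intro g
    convert tendsto_card_filter_natCast_eq_div (e.symm g) using 7 with n x
    rw [RingEquiv.eq_symm_apply, map_natCast]
    rfl
  let S : Finset (Fin k → (p : T) → ZMod p) :=
    {s | ∀ p : T, ∀ i j, i ≠ j → ¬(s i p = 0 ∧ s j p = 0)}
  have hS : #S = ∏ p : T, #{v : Fin k → ZMod p | ∀ i j, i ≠ j → ¬(v i = 0 ∧ v j = 0)} := by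
    rw [← Fintype.card_piFinset]
    refine card_equiv (Equiv.piComm _) fun s => ?_
    simp [S, Equiv.piComm]
  have hlim := tendsto_card_piFinset_filter_mem_div hfib S
  convert hlim using 6 with n
  · simp [S, ZMod.natCast_eq_zero_iff]
  · rw [hS, ← prod_coe_sort T, Nat.cast_prod, Nat.cast_prod, ← prod_inv_distrib, ← prod_pow,
      ← prod_mul_distrib]
    refine prod_congr rfl fun p _ => ?_
    obtain ⟨m, rfl⟩ := Nat.exists_eq_add_of_le' hk
    have hp : ((p : ℕ) : ℝ) ≠ 0 := Nat.cast_ne_zero.2 (hT p p.2).ne_zero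
    rw [card_filter_at_most_one_zero]
    push_cast [Nat.cast_sub (hT p p.2).one_le]
    rw [one_sub_div hp, div_pow, inv_pow]
    field_simp
    ring

/-- At most `n ^ k / p ^ 2` tuples in `[n] ^ k` have two given coordinates divisible by `p`. -/
lemma card_filter_dvd_dvd_le (k n p : ℕ) {i j : Fin k} (hij : i ≠ j) :
    (#{x ∈ Fintype.piFinset fun _ : Fin k => Icc 1 n | p ∣ x i ∧ p ∣ x j} : ℝ)
      ≤ (n : ℝ) ^ k * ((p : ℝ) ^ 2)⁻¹ := by
  have hset : {x ∈ Fintype.piFinset fun _ : Fin k => Icc 1 n | p ∣ x i ∧ p ∣ x j}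
      = Fintype.piFinset fun l => if l ∈ ({i, j} : Finset (Fin k))
        then {x ∈ Icc 1 n | p ∣ x} else Icc 1 n := by
    ext x
    simp only [mem_filter, Fintype.mem_piFinset, mem_insert, mem_singleton]
    constructor
    · rintro ⟨h, hi, hj⟩ l
      split_ifs with hl
      · rcases hl with rfl | rfl <;> simp_all
      · exact h l
    · intro h
      refine ⟨fun l => ?_, ?_, ?_⟩
      · have := h l
        split_ifs at this
        exacts [(mem_filter.1 this).1, this]
      · have := h i
        simp_all
      · have := h j
        simp_all
  rw [hset, Fintype.card_piFinset, Nat.cast_prod]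
  calc ∏ l, (#(if l ∈ ({i, j} : Finset (Fin k)) then {x ∈ Icc 1 n | p ∣ x} else Icc 1 n) : ℝ)
      ≤ ∏ l, ((n : ℝ) * if l ∈ ({i, j} : Finset (Fin k)) then (p : ℝ)⁻¹ else 1) := by
        refine prod_le_prod (fun _ _ => by positivity) fun l _ => ?_
        split_ifs
        · have : #{x ∈ Icc 1 n | p ∣ x} = n / p := Nat.Ioc_filter_dvd_card_eq_div n p
          rw [this, ← div_eq_mul_inv]
          exact Nat.cast_div_le
        · simp
    _ = (n : ℝ) ^ k * ((p : ℝ) ^ 2)⁻¹ := by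
        rw [prod_mul_distrib, prod_ite_mem, univ_inter, prod_const, prod_const, card_pair hij]
        simp

/-- Sieving only by the primes below `N` overcounts the pairwise coprime tuples by `O(1 / N)`. -/
lemma abs_card_sub_card_div_le (k N n : ℕ) :
    |(#{x ∈ Fintype.piFinset fun _ : Fin k => Icc 1 n |
        ∀ i j, i ≠ j → Nat.gcd (x i) (x j) = 1} : ℝ) / (n : ℝ) ^ k
      - (#{x ∈ Fintype.piFinset fun _ : Fin k => Icc 1 n |
        ∀ p ∈ (range N).filter Nat.Prime, ∀ i j, i ≠ j → ¬(p ∣ x i ∧ p ∣ x j)} : ℝ) / (n : ℝ) ^ k|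
      ≤ (k : ℝ) ^ 2 * (2 / (((N - 1 : ℕ) : ℝ) + 1)) := by
  set B := Fintype.piFinset fun _ : Fin k => Icc 1 n
  set C := {x ∈ B | ∀ i j, i ≠ j → Nat.gcd (x i) (x j) = 1} with hC
  set D := {x ∈ B | ∀ p ∈ (range N).filter Nat.Prime, ∀ i j, i ≠ j → ¬(p ∣ x i ∧ p ∣ x j)} with hD
  have hCD : C ⊆ D := by
    intro x hx
    rw [hC, mem_filter] at hx
    rw [hD, mem_filter]
    refine ⟨hx.1, fun p hp i j hij h => ?_⟩
    exact Nat.not_coprime_of_dvd_of_dvd (mem_filter.1 hp).2.one_lt h.1 h.2 (hx.2 i j hij)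
  have hsub : D \ C ⊆ (univ : Finset (Fin k)).offDiag.biUnion fun ij =>
      (Ioo (N - 1) (n + 1)).biUnion fun p => {x ∈ B | p ∣ x ij.1 ∧ p ∣ x ij.2} := by
    intro x hx
    rw [Finset.mem_sdiff, hC, hD, mem_filter, mem_filter] at hx
    obtain ⟨⟨hxB, hxD⟩, hxC⟩ := hx
    have hnot : ∃ i j, i ≠ j ∧ ¬Nat.Coprime (x i) (x j) := by
      by_contra! h
      exact hxC ⟨hxB, h⟩
    obtain ⟨i, j, hij, hg⟩ := hnot
    obtain ⟨p, hp, hpi, hpj⟩ := Nat.Prime.not_coprime_iff_dvd.1 hg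
    have hxi := mem_Icc.1 (Fintype.mem_piFinset.1 hxB i)
    have hNp : N ≤ p := by
      by_contra! h
      exact hxD p (mem_filter.2 ⟨mem_range.2 h, hp⟩) i j hij ⟨hpi, hpj⟩
    have hpn := Nat.le_of_dvd hxi.1 hpi
    have hp0 := hp.pos
    simp only [mem_biUnion, mem_filter]
    exact ⟨(i, j), by simpa using hij, p, mem_Ioo.2 ⟨by omega, by omega⟩, hxB, hpi, hpj⟩
  have hcard : (#(D \ C) : ℝ) ≤ (k : ℝ) ^ 2 * ((n : ℝ) ^ k * (2 / (((N - 1 : ℕ) : ℝ) + 1))) := by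
    calc (#(D \ C) : ℝ)
        ≤ ∑ ij ∈ (univ : Finset (Fin k)).offDiag, ∑ p ∈ Ioo (N - 1) (n + 1),
            (#{x ∈ B | p ∣ x ij.1 ∧ p ∣ x ij.2} : ℝ) := by
          exact_mod_cast (card_le_card hsub).trans
            (card_biUnion_le.trans (sum_le_sum fun _ _ => card_biUnion_le))
      _ ≤ ∑ ij ∈ (univ : Finset (Fin k)).offDiag,
            (n : ℝ) ^ k * (2 / (((N - 1 : ℕ) : ℝ) + 1)) := by
          refine sum_le_sum fun ij hij => ?_
          calc _ ≤ ∑ p ∈ Ioo (N - 1) (n + 1), (n : ℝ) ^ k * ((p : ℝ) ^ 2)⁻¹ :=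
                sum_le_sum fun p _ => card_filter_dvd_dvd_le k n p (mem_offDiag.1 hij).2.2
            _ ≤ _ := by
                rw [← mul_sum]
                gcongr
                exact sum_Ioo_inv_sq_le _ _
      _ ≤ _ := by
          rw [sum_const, nsmul_eq_mul]
          gcongr
          rw [offDiag_card, card_univ, Fintype.card_fin, sq]
          exact_mod_cast Nat.sub_le _ _
  rw [abs_sub_comm, ← sub_div, ← Nat.cast_sub (card_le_card hCD), ← card_sdiff_of_subset hCD,
    abs_of_nonneg (by positivity)]
  refine div_le_of_le_mul₀ (by positivity) (by positivity) (hcard.trans_eq (by ring))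

lemma eulerFactor_nonneg {k p : ℕ} (hk : 1 ≤ k) (hp : 1 ≤ p) :
    0 ≤ (1 - 1 / (p : ℝ)) ^ (k - 1) * (1 + ((k : ℝ) - 1) / (p : ℝ)) := by
  have hk' : (0 : ℝ) ≤ (k : ℝ) - 1 := sub_nonneg.2 (by exact_mod_cast hk)
  have hp' : 1 / (p : ℝ) ≤ 1 := div_le_one_of_le₀ (by exact_mod_cast hp) (by positivity)
  have := sub_nonneg.2 hp'
  positivity

lemma eulerFactor_le_one {k p : ℕ} (hk : 1 ≤ k) (hp : 1 ≤ p) :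
    (1 - 1 / (p : ℝ)) ^ (k - 1) * (1 + ((k : ℝ) - 1) / (p : ℝ)) ≤ 1 := by
  obtain ⟨m, rfl⟩ := Nat.exists_eq_add_of_le' hk
  have hp' : 1 / (p : ℝ) ≤ 1 := div_le_one_of_le₀ (by exact_mod_cast hp) (by positivity)
  have hp0 : 0 ≤ 1 / (p : ℝ) := by positivity
  have hbern : 1 + (m : ℝ) * (1 / p) ≤ (1 + 1 / (p : ℝ)) ^ m :=
    one_add_mul_le_pow (by linarith) m
  calc (1 - 1 / (p : ℝ)) ^ (m + 1 - 1) * (1 + (((m + 1 : ℕ) : ℝ) - 1) / (p : ℝ))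
      = (1 - 1 / (p : ℝ)) ^ m * (1 + (m : ℝ) * (1 / p)) := by
        rw [Nat.add_sub_cancel]
        push_cast
        ring
    _ ≤ (1 - 1 / (p : ℝ)) ^ m * (1 + 1 / (p : ℝ)) ^ m :=
        mul_le_mul_of_nonneg_left hbern (pow_nonneg (by linarith) m)
    _ = ((1 - 1 / (p : ℝ)) * (1 + 1 / (p : ℝ))) ^ m := (mul_pow _ _ _).symm
    _ ≤ 1 := pow_le_one₀ (mul_nonneg (by linarith) (by linarith)) (by nlinarith)

/-- The limiting probability that `k` independent uniform random integers in `[n]`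
are pairwise coprime equals `∏_{p prime} (1 − 1/p)^{k−1} (1 + (k−1)/p)`. -/
theorem pairwise_coprime_tendsto (k : ℕ) (hk : 1 ≤ k) :
    ∃ L : ℝ,
      Tendsto (fun N : ℕ =>
          ∏ p ∈ (Finset.range N).filter Nat.Prime,
            (1 - 1 / (p : ℝ)) ^ (k - 1) * (1 + ((k : ℝ) - 1) / (p : ℝ)))
        atTop (nhds L) ∧
      Tendsto (fun n : ℕ =>
          (((Fintype.piFinset fun _ : Fin k => Finset.Icc 1 n).filter
              (fun x => ∀ i j : Fin k, i ≠ j → Nat.gcd (x i) (x j) = 1)).card : ℝ)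
            / (n : ℝ) ^ k)
        atTop (nhds L) := by
  have hprime : ∀ {N p : ℕ}, p ∈ (range N).filter Nat.Prime → 1 ≤ p := fun hp =>
    (mem_filter.1 hp).2.one_le
  have hanti : Antitone fun N : ℕ => ∏ p ∈ (range N).filter Nat.Prime,
      (1 - 1 / (p : ℝ)) ^ (k - 1) * (1 + ((k : ℝ) - 1) / (p : ℝ)) := fun N N' h =>
    prod_le_prod_of_subset_of_le_one (filter_subset_filter _ (range_mono h))
      (fun p hp => eulerFactor_nonneg hk (hprime hp))
      (fun p hp _ => eulerFactor_le_one hk (hprime hp))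
  have hbdd : BddBelow (Set.range fun N : ℕ => ∏ p ∈ (range N).filter Nat.Prime,
      (1 - 1 / (p : ℝ)) ^ (k - 1) * (1 + ((k : ℝ) - 1) / (p : ℝ))) := by
    refine ⟨0, ?_⟩
    rintro _ ⟨N, rfl⟩
    exact prod_nonneg fun p hp => eulerFactor_nonneg hk (hprime hp)
  have hprod := tendsto_atTop_ciInf hanti hbdd
  refine ⟨_, hprod, ?_⟩
  refine TendstoUniformly.tendsto_of_eventually_tendsto (p := atTop)
    (F := fun N n : ℕ => (#{x ∈ Fintype.piFinset fun _ : Fin k => Icc 1 n |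
      ∀ p ∈ (range N).filter Nat.Prime, ∀ i j, i ≠ j → ¬(p ∣ x i ∧ p ∣ x j)} : ℝ) / (n : ℝ) ^ k)
    ?_ (Eventually.of_forall fun N => tendsto_card_no_common_prime_div hk
      fun p hp => (mem_filter.1 hp).2) hprod
  have herr : Tendsto (fun N : ℕ => (k : ℝ) ^ 2 * (2 / (((N - 1 : ℕ) : ℝ) + 1))) atTop (𝓝 0) := by
    have h1 : Tendsto (fun N : ℕ => ((N - 1 : ℕ) : ℝ) + 1) atTop atTop :=
      tendsto_atTop_add_const_right _ _
        (tendsto_natCast_atTop_atTop.comp (tendsto_sub_atTop_nat 1))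
    simpa using (h1.const_div_atTop 2).const_mul ((k : ℝ) ^ 2)
  rw [Metric.tendstoUniformly_iff]
  intro ε hε
  filter_upwards [herr.eventually_lt_const hε] with N hN n
  exact (abs_card_sub_card_div_le k N n).trans_lt hN
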